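/- arXiv:1807.01913 — 3 statements merged into one kernel-verified Lean document; each statement's English description precedes it below -/
import Mathlib

section
/- Let S : ℝ → ℝ be continuously differentiable with derivative S' satisfying 0 ≤ S'(z) ≤ S_L for all z ∈ ℝ, and define Θ : ℝ → ℝ by Θ(ξ) = ∫₀^ξ S'(z) z dz. Then for all ξ₁, ξ₂ ∈ ℝ one has Θ(ξ₁) − Θ(ξ₂) ≤ (S(ξ₁) − S(ξ₂)) ξ₁. -/
open intervalIntegral

/-- If `S : ℝ → ℝ` is continuously differentiable with derivative `S'`
satisfying `0 ≤ S' z ≤ S_L` for all `z`, and `Θ ξ = ∫ z in 0..ξ, S' z * z`, then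
`Θ ξ₁ - Θ ξ₂ ≤ (S ξ₁ - S ξ₂) * ξ₁` for all `ξ₁ ξ₂ : ℝ`. -/
theorem stmt0_theta_ineq (S S' : ℝ → ℝ) (S_L : ℝ)
    (hderiv : ∀ z : ℝ, HasDerivAt S (S' z) z)
    (hcont : Continuous S')
    (hbound : ∀ z : ℝ, 0 ≤ S' z ∧ S' z ≤ S_L)
    (Θ : ℝ → ℝ)
    (hΘ : ∀ ξ : ℝ, Θ ξ = ∫ z in (0:ℝ)..ξ, S' z * z) :
    ∀ ξ₁ ξ₂ : ℝ, Θ ξ₁ - Θ ξ₂ ≤ (S ξ₁ - S ξ₂) * ξ₁ := by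
  intro a b
  have hc : Continuous fun z => S' z * z := hcont.mul continuous_id
  have h1 : Θ a - Θ b = ∫ z in b..a, S' z * z := by
    rw [hΘ, hΘ]
    exact integral_interval_sub_left (hc.intervalIntegrable _ _) (hc.intervalIntegrable _ _)
  have h2 : (S a - S b) * a = ∫ z in b..a, S' z * a := by
    rw [intervalIntegral.integral_mul_const,
      integral_eq_sub_of_hasDerivAt (fun z _ => hderiv z) (hcont.intervalIntegrable _ _)]
  have hc2 : Continuous fun z => S' z * a := hcont.mul continuous_const
  rw [h1, h2]
  rcases le_total b a with h | h
  · apply integral_mono_on h (hc.intervalIntegrable _ _) (hc2.intervalIntegrable _ _)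
    intro z hz
    exact mul_le_mul_of_nonneg_left hz.2 (hbound z).1
  · rw [integral_symm a b, integral_symm a b]
    apply neg_le_neg
    apply integral_mono_on h (hc2.intervalIntegrable _ _) (hc.intervalIntegrable _ _)
    intro z hz
    exact mul_le_mul_of_nonneg_left hz.1 (hbound z).1
end

section
/- Let (M, μ) be a σ-finite measure space, let fₙ, gₙ ∈ L¹(μ) be sequences and f, g, h ∈ L¹(μ) be such that: fₙ → f μ-almost everywhere in M; gₙ ⇀ g weakly in L¹(μ); fₙ gₙ ∈ L¹(μ) for every n; and fₙ gₙ ⇀ h weakly in L¹(μ). Then h = f g μ-almost everywhere in M. -/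
open MeasureTheory Filter

lemma aux_bdd {M : Type*} [MeasurableSpace M] (μ : Measure M)
    (gn : ℕ → M → ℝ) (g : M → ℝ) (hgn_int : ∀ n, Integrable (gn n) μ)
    (hgn_weak : ∀ φ : M → ℝ, Measurable φ → (∃ C : ℝ, ∀ x, |φ x| ≤ C) →
      Tendsto (fun n => ∫ x, gn n x * φ x ∂μ) atTop (nhds (∫ x, g x * φ x ∂μ))) :
    ∃ C : ℝ, ∀ n, ∫ x, |gn n x| ∂μ ≤ C := by
  let T : ℕ → (Lp ℝ ⊤ μ →L[ℝ] ℝ) := fun n =>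
    (ContinuousLinearMap.mul ℝ ℝ).lpPairing μ 1 ⊤ ((hgn_int n).toL1 (gn n))
  have hT : ∀ n (φ : Lp ℝ ⊤ μ), T n φ = ∫ x, gn n x * φ x ∂μ := by
    intro n φ
    simp only [T]
    rw [ContinuousLinearMap.lpPairing_eq_integral]
    apply integral_congr_ae
    filter_upwards [(hgn_int n).coeFn_toL1] with x hx
    rw [hx, ContinuousLinearMap.mul_apply']
  obtain ⟨C, hC⟩ : ∃ C, ∀ n, ‖T n‖ ≤ C := by
    apply banach_steinhaus
    intro φ
    have hm : Measurable (fun x => max (-‖φ‖) (min ‖φ‖ (φ x))) :=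
      measurable_const.max (measurable_const.min (Lp.stronglyMeasurable φ).measurable)
    have hlim := hgn_weak _ hm ⟨‖φ‖, fun x => abs_le.2 ⟨le_max_left _ _,
      max_le (by linarith [norm_nonneg φ]) (min_le_left _ _)⟩⟩
    obtain ⟨C, hC⟩ := hlim.norm.bddAbove_range
    refine ⟨C, fun n => ?_⟩
    refine le_trans (le_of_eq ?_) (hC ⟨n, rfl⟩)
    rw [hT]
    congr 1
    apply integral_congr_ae
    have hb : ∀ᵐ x ∂μ, ‖φ x‖ ≤ ‖φ‖ := by
      have h1 := ae_le_eLpNormEssSup (f := φ) (μ := μ)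
      have h2 : eLpNormEssSup φ μ = ENNReal.ofReal ‖φ‖ := by
        rw [Lp.norm_def, ENNReal.ofReal_toReal (Lp.eLpNorm_ne_top φ), eLpNorm_exponent_top]
      filter_upwards [h1] with x hx
      rw [h2, ← ofReal_norm] at hx
      exact (ENNReal.ofReal_le_ofReal_iff (norm_nonneg _)).1 hx
    filter_upwards [hb] with x hx
    rw [Real.norm_eq_abs, abs_le] at hx
    rw [min_eq_right hx.2, max_eq_right hx.1]
  refine ⟨C, fun n => ?_⟩
  let gm := (hgn_int n).1.mk (gn n)
  have hgm : Measurable gm := (hgn_int n).1.stronglyMeasurable_mk.measurable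
  have hgme : gn n =ᵐ[μ] gm := (hgn_int n).1.ae_eq_mk
  let s : M → ℝ := fun x => if 0 ≤ gm x then 1 else -1
  have hs : Measurable s :=
    Measurable.ite (measurableSet_le measurable_const hgm) measurable_const measurable_const
  have hsb : ∀ x, ‖s x‖ ≤ 1 := by
    intro x; simp only [s]; split_ifs <;> simp
  have hsm : MemLp s ⊤ μ := memLp_top_of_bound hs.aestronglyMeasurable 1 (.of_forall hsb)
  have hn : ‖hsm.toLp s‖ ≤ 1 := by
    rw [Lp.norm_toLp]
    apply ENNReal.toReal_le_of_le_ofReal zero_le_one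
    rw [eLpNorm_exponent_top]
    exact eLpNormEssSup_le_of_ae_bound (.of_forall hsb)
  have h1 : ∫ x, |gn n x| ∂μ = T n (hsm.toLp s) := by
    rw [hT]
    apply integral_congr_ae
    filter_upwards [hgme, hsm.coeFn_toLp] with x hx hx'
    rw [hx', hx]
    simp only [s]
    split_ifs with h0
    · rw [abs_of_nonneg h0, mul_one]
    · rw [abs_of_neg (not_le.1 h0)]; ring
  rw [h1]
  calc T n (hsm.toLp s) ≤ ‖T n (hsm.toLp s)‖ := le_abs_self _
    _ ≤ ‖T n‖ * ‖hsm.toLp s‖ := (T n).le_opNorm _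
    _ ≤ ‖T n‖ * 1 := by gcongr
    _ ≤ C := by rw [mul_one]; exact hC n

lemma aux_meas {M : Type*} [MeasurableSpace M] (μ : Measure M) [SigmaFinite μ]
    (fn gn : ℕ → M → ℝ) (f g h : M → ℝ)
    (hfn : ∀ n, StronglyMeasurable (fn n)) (hf : StronglyMeasurable f)
    (hgn_int : ∀ n, Integrable (gn n) μ)
    (hg_int : Integrable g μ) (hh_int : Integrable h μ)
    (hfn_ae : ∀ᵐ x ∂μ, Tendsto (fun n => fn n x) atTop (nhds (f x)))
    (hgn_weak : ∀ φ : M → ℝ, Measurable φ → (∃ C : ℝ, ∀ x, |φ x| ≤ C) →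
      Tendsto (fun n => ∫ x, gn n x * φ x ∂μ) atTop (nhds (∫ x, g x * φ x ∂μ)))
    (hprod_int : ∀ n, Integrable (fun x => fn n x * gn n x) μ)
    (hprod_weak : ∀ φ : M → ℝ, Measurable φ → (∃ C : ℝ, ∀ x, |φ x| ≤ C) →
      Tendsto (fun n => ∫ x, fn n x * gn n x * φ x ∂μ) atTop
        (nhds (∫ x, h x * φ x ∂μ))) :
    ∀ᵐ x ∂μ, h x = f x * g x := by
  obtain ⟨C, hC⟩ := aux_bdd μ gn g hgn_int hgn_weak
  have hC0 : 0 ≤ C := le_trans (integral_nonneg fun x => abs_nonneg _) (hC 0)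
  -- on a set of uniform convergence where f is bounded
  have key : ∀ (E : Set M) (K : ℝ), MeasurableSet E → (∀ x ∈ E, |f x| ≤ K) →
      TendstoUniformlyOn fn f atTop E → ∀ᵐ x ∂μ, x ∈ E → h x = f x * g x := by
    intro E K hE hK hu
    rw [← ae_restrict_iff' hE]
    have hfgE : Integrable (fun x => f x * g x) (μ.restrict E) :=
      hg_int.restrict.bdd_mul (c := K) hf.aestronglyMeasurable
        ((ae_restrict_iff' hE).2 (.of_forall hK))
    refine Integrable.ae_eq_of_forall_setIntegral_eq _ _ hh_int.restrict hfgE ?_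
    intro s hs _
    rw [Measure.restrict_restrict hs]
    set F := s ∩ E with hF
    have hFm : MeasurableSet F := hs.inter hE
    have hFE : F ⊆ E := Set.inter_subset_right
    have hu' := hu.mono hFE
    have conv : ∀ (u v : M → ℝ), (∫ x, u x * F.indicator v x ∂μ) = ∫ x in F, u x * v x ∂μ := by
      intro u v
      rw [← integral_indicator hFm]
      congr 1
      ext x
      by_cases hx : x ∈ F <;> simp [hx]
    have l1 := hprod_weak (F.indicator (fun _ => 1)) (measurable_const.indicator hFm)
      ⟨1, fun x => by by_cases hx : x ∈ F <;> simp [hx]⟩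
    have l2 := hgn_weak (F.indicator f) (hf.measurable.indicator hFm)
      ⟨max K 0, fun x => by
        by_cases hx : x ∈ F
        · simp [hx, hK x (hFE hx)]
        · simp [hx]⟩
    simp only [conv, mul_one] at l1 l2
    have hfg' : ∀ n, IntegrableOn (fun x => gn n x * f x) F μ := fun n =>
      (hgn_int n).integrableOn.mul_bdd (c := K) hf.aestronglyMeasurable
        ((ae_restrict_iff' hFm).2 (.of_forall fun x hx => hK x (hFE hx)))
    have l3 : Tendsto (fun n => (∫ x in F, fn n x * gn n x ∂μ) - ∫ x in F, gn n x * f x ∂μ)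
        atTop (nhds 0) := by
      rw [Metric.tendsto_atTop]
      intro ε hε
      have hδ : 0 < ε / (C + 1) := by positivity
      obtain ⟨N, hN⟩ := eventually_atTop.1 (Metric.tendstoUniformlyOn_iff.1 hu' _ hδ)
      refine ⟨N, fun n hn => ?_⟩
      rw [dist_zero_right, ← integral_sub (hprod_int n).integrableOn (hfg' n)]
      calc ‖∫ x in F, (fn n x * gn n x - gn n x * f x) ∂μ‖
          ≤ ∫ x in F, ε / (C + 1) * |gn n x| ∂μ := by
            apply norm_integral_le_of_norm_le ((hgn_int n).abs.integrableOn.const_mul _)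
            refine (ae_restrict_iff' hFm).2 (.of_forall fun x hx => ?_)
            have := hN n hn x hx
            rw [dist_comm, Real.dist_eq] at this
            rw [show fn n x * gn n x - gn n x * f x = (fn n x - f x) * gn n x by ring,
              Real.norm_eq_abs, abs_mul]
            gcongr
        _ = ε / (C + 1) * ∫ x in F, |gn n x| ∂μ := integral_const_mul _ _
        _ ≤ ε / (C + 1) * C := by
            gcongr
            exact (setIntegral_le_integral (hgn_int n).abs
              (.of_forall fun x => abs_nonneg _)).trans (hC n)
        _ < ε := by
            rw [div_mul_eq_mul_div, div_lt_iff₀ (by positivity)]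
            nlinarith
    have l4 := tendsto_nhds_unique l3 (l1.sub l2)
    rw [show (∫ x in F, f x * g x ∂μ) = ∫ x in F, g x * f x ∂μ by simp only [mul_comm]]
    linarith
  -- exhaustion
  let A : ℕ → Set M := fun k => spanningSets μ k ∩ {x | |f x| ≤ k}
  have hA : ∀ k, MeasurableSet (A k) := fun k =>
    (measurableSet_spanningSets μ k).inter
      (measurableSet_le hf.measurable.abs measurable_const)
  have step : ∀ k, ∀ᵐ x ∂μ, x ∈ A k → h x = f x * g x := by
    intro k
    have hfin : μ (A k) ≠ ⊤ :=
      ((measure_mono Set.inter_subset_left).trans_lt (measure_spanningSets_lt_top μ k)).ne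
    rw [ae_iff]
    refine le_antisymm (ENNReal.le_of_forall_pos_le_add fun ε hε _ => ?_) zero_le
    obtain ⟨t, -, htm, htμ, htu⟩ := tendstoUniformlyOn_of_ae_tendsto (μ := μ) hfn hf (hA k) hfin
      (by filter_upwards [hfn_ae] with x hx _ using hx) (ε := ε) (by exact_mod_cast hε)
    have h1 := key (A k \ t) k ((hA k).diff htm) (fun x hx => hx.1.2) htu
    rw [ae_iff] at h1
    calc μ {x | ¬ (x ∈ A k → h x = f x * g x)}
        ≤ μ ({x | ¬ (x ∈ A k \ t → h x = f x * g x)} ∪ t) := by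
          apply measure_mono
          intro x hx
          simp only [Set.mem_ofPred_eq, Set.mem_union, Set.mem_sdiff] at hx ⊢
          tauto
      _ ≤ _ := measure_union_le _ _
      _ ≤ 0 + ε := by
          rw [h1]
          gcongr
          simpa using htμ
  filter_upwards [ae_all_iff.2 step] with x hx
  obtain ⟨i, hi⟩ := Set.mem_iUnion.1 ((iUnion_spanningSets μ).symm ▸ Set.mem_univ x :
    x ∈ ⋃ i, spanningSets μ i)
  obtain ⟨j, hj⟩ := exists_nat_ge |f x|
  refine hx (max i j) ⟨monotone_spanningSets μ (le_max_left _ _) hi, hj.trans ?_⟩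
  exact_mod_cast le_max_right i j

/-- Lemma 4.2 of Li–Sun. Let `(M, μ)` be a σ-finite measure space,
`fₙ, gₙ ∈ L¹(μ)`, `f, g, h ∈ L¹(μ)`, with `fₙ → f` a.e., `gₙ ⇀ g` weakly in `L¹`
(i.e. tested against all bounded measurable functions), `fₙ gₙ ∈ L¹` and
`fₙ gₙ ⇀ h` weakly in `L¹`.  Then `h = f g` μ-a.e. -/
theorem stmt5_weak_L1_product_limit
    {M : Type*} [MeasurableSpace M] (μ : Measure M) [SigmaFinite μ]
    (fn gn : ℕ → M → ℝ) (f g h : M → ℝ)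
    (hfn_int : ∀ n, Integrable (fn n) μ)
    (hgn_int : ∀ n, Integrable (gn n) μ)
    (hf_int : Integrable f μ) (hg_int : Integrable g μ) (hh_int : Integrable h μ)
    (hfn_ae : ∀ᵐ x ∂μ, Tendsto (fun n => fn n x) atTop (nhds (f x)))
    (hgn_weak : ∀ φ : M → ℝ, Measurable φ → (∃ C : ℝ, ∀ x, |φ x| ≤ C) →
      Tendsto (fun n => ∫ x, gn n x * φ x ∂μ) atTop (nhds (∫ x, g x * φ x ∂μ)))
    (hprod_int : ∀ n, Integrable (fun x => fn n x * gn n x) μ)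
    (hprod_weak : ∀ φ : M → ℝ, Measurable φ → (∃ C : ℝ, ∀ x, |φ x| ≤ C) →
      Tendsto (fun n => ∫ x, fn n x * gn n x * φ x ∂μ) atTop
        (nhds (∫ x, h x * φ x ∂μ))) :
    ∀ᵐ x ∂μ, h x = f x * g x := by
  have e : ∀ᵐ x ∂μ, ∀ n, fn n x = (hfn_int n).1.mk (fn n) x :=
    ae_all_iff.2 fun n => (hfn_int n).1.ae_eq_mk
  have e' : ∀ᵐ x ∂μ, f x = hf_int.1.mk f x := hf_int.1.ae_eq_mk
  have := aux_meas μ (fun n => (hfn_int n).1.mk (fn n)) gn (hf_int.1.mk f) g h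
    (fun n => (hfn_int n).1.stronglyMeasurable_mk) hf_int.1.stronglyMeasurable_mk hgn_int hg_int
    hh_int
    (by
      filter_upwards [e, e', hfn_ae] with x h1 h2 h3
      simpa only [h1, h2] using h3)
    hgn_weak
    (fun n => (hprod_int n).congr (by
      filter_upwards [e] with x h1
      rw [h1 n]))
    (fun φ h1 h2 => (hprod_weak φ h1 h2).congr fun n => integral_congr_ae (by
      filter_upwards [e] with x h1
      rw [h1 n]))
  filter_upwards [this, e'] with x h1 h2
  rw [h1, h2]
end

section
/- Let wₙ, w : Ω_T → ℝ be measurable with |wₙ(x,t)| ≤ M for all n and a.e. (x,t) ∈ Ω_T and wₙ → w a.e. in Ω_T, let χ : ℝ² → ℝ be measurable, Y-periodic and bounded, let εₙ → 0⁺, let φ : cl(Ω) × [0,T] → ℝ be continuous and bounded, and let φ₁ : cl(Ω) × ℝ² × [0,T] → ℝ be continuous, bounded and Y-periodic in its second argument. Then ∫_{Ω_T} χ(x/εₙ) wₙ(x,t) [φ(x,t) + εₙ φ₁(x, x/εₙ, t)] dx dt → (∫_Y χ(y) dy) ∫_{Ω_T} w(x,t) φ(x,t) dx dt as n → ∞.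 -/
open MeasureTheory Filter

instance aux_inv2 : (volume : Measure (ℝ × ℝ)).IsAddHaarMeasure :=
  inferInstanceAs ((volume : Measure ℝ).prod (volume : Measure ℝ)).IsAddHaarMeasure

instance aux_inv3 : (volume : Measure ((ℝ × ℝ) × ℝ)).IsAddHaarMeasure :=
  inferInstanceAs ((volume : Measure (ℝ × ℝ)).prod (volume : Measure ℝ)).IsAddHaarMeasure

theorem aux_trans_gen {G : Type*} [NormedAddCommGroup G] [NormedSpace ℝ G]
    [FiniteDimensional ℝ G] [MeasureSpace G] [BorelSpace G]
    [(volume : Measure G).IsAddHaarMeasure] (g : G → ℝ) (hg : Integrable g)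
    (v : ℕ → G) (hv : Tendsto v atTop (nhds 0)) :
    Tendsto (fun n => ∫ q, ‖g (v n + q) - g q‖) atTop (nhds 0) := by
  have : ProperSpace G := FiniteDimensional.proper ℝ G
  have : Fact ((1 : ENNReal) ≠ ⊤) := ⟨ENNReal.one_ne_top⟩
  have hm : MemLp g 1 volume := memLp_one_iff_integrable.2 hg
  have hc : Continuous (fun u : G => DomAddAct.mk u +ᵥ hm.toLp g) := by
    exact (DomAddAct.mkHomeomorph.continuous).vadd continuous_const
  have h1 := (hc.tendsto 0).comp hv
  rw [tendsto_iff_dist_tendsto_zero] at h1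
  refine h1.congr fun n => ?_
  have hs : MemLp (fun q => g (v n + q)) 1 volume :=
    hm.comp_measurePreserving (measurePreserving_add_left volume (v n))
  have e1 : DomAddAct.mk (v n) +ᵥ hm.toLp g = hs.toLp _ := DomAddAct.mk_vadd_toLp _ hm
  have e2 : DomAddAct.mk (0 : G) +ᵥ hm.toLp g = hm.toLp g := by simp
  simp only [Function.comp, e1, e2]
  rw [dist_eq_norm, ← MemLp.toLp_sub, Lp.norm_toLp, eLpNorm_one_eq_lintegral_enorm,
    integral_norm_eq_lintegral_enorm]
  · rfl
  · exact (hs.sub hm).1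

theorem aux_trans (g : (ℝ × ℝ) × ℝ → ℝ) (hg : Integrable g)
    (v : ℕ → (ℝ × ℝ) × ℝ) (hv : Tendsto v atTop (nhds 0)) :
    Tendsto (fun n => ∫ q, ‖g (v n + q) - g q‖) atTop (nhds 0) :=
  aux_trans_gen g hg v hv

theorem aux_per1 (f : ℝ → ℝ) (hf : Function.Periodic f 1) (z : ℝ) :
    ∫ y in Set.Icc (0:ℝ) 1, f (z + y) = ∫ y in Set.Icc (0:ℝ) 1, f y := by
  rw [integral_Icc_eq_integral_Ioc, integral_Icc_eq_integral_Ioc,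
    ← intervalIntegral.integral_of_le zero_le_one, ← intervalIntegral.integral_of_le zero_le_one,
    intervalIntegral.integral_comp_add_left]
  simpa using hf.intervalIntegral_add_eq z 0

theorem aux_per2 (χ : (ℝ × ℝ) → ℝ) (hχ_meas : Measurable χ)
    (hχ_per : ∀ (y : ℝ × ℝ) (k : ℤ),
      χ (y + (k : ℝ) • ((1 : ℝ), (0 : ℝ))) = χ y ∧
      χ (y + (k : ℝ) • ((0 : ℝ), (1 : ℝ))) = χ y)
    (K : ℝ) (hK : ∀ y, |χ y| ≤ K) (z : ℝ × ℝ) :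
    ∫ y in Set.Icc ((0:ℝ), (0:ℝ)) (1, 1), χ (z + y) =
      ∫ y in Set.Icc ((0:ℝ), (0:ℝ)) (1, 1), χ y := by
  have key : ∀ f : ℝ × ℝ → ℝ, Measurable f → (∀ y, |f y| ≤ K) →
      ∫ y in Set.Icc ((0:ℝ), (0:ℝ)) (1, 1), f y =
        ∫ a in Set.Icc (0:ℝ) 1, ∫ b in Set.Icc (0:ℝ) 1, f (a, b) := by
    intro f hf hb
    rw [← Set.Icc_prod_Icc]
    refine setIntegral_prod f ?_
    refine Measure.integrableOn_of_bounded (M := K) ?_ hf.aestronglyMeasurable ?_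
    · exact (isCompact_Icc.prod isCompact_Icc).measure_lt_top.ne
    · exact Eventually.of_forall hb
  rw [key (fun y => χ (z + y)) (hχ_meas.comp (measurable_const_add z)) (fun y => hK _), key _ hχ_meas hK]
  have p1 : ∀ b, Function.Periodic (fun a => χ (a, b)) 1 := fun b a => by
    simpa using (hχ_per (a, b) 1).1
  have p2 : ∀ a, Function.Periodic (fun b => χ (a, b)) 1 := fun a b => by
    simpa using (hχ_per (a, b) 1).2
  have h1 : ∀ a, ∫ b in Set.Icc (0:ℝ) 1, χ (z + (a, b)) =
      ∫ b in Set.Icc (0:ℝ) 1, χ (z.1 + a, b) := fun a =>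
    aux_per1 _ (p2 (z.1 + a)) z.2
  simp_rw [h1]
  refine aux_per1 (fun a => ∫ b in Set.Icc (0:ℝ) 1, χ (a, b)) ?_ z.1
  intro a
  simp only [fun b => p1 b a]

theorem aux_weak (χ : (ℝ × ℝ) → ℝ) (hχ_meas : Measurable χ)
    (hχ_per : ∀ (y : ℝ × ℝ) (k : ℤ),
      χ (y + (k : ℝ) • ((1 : ℝ), (0 : ℝ))) = χ y ∧
      χ (y + (k : ℝ) • ((0 : ℝ), (1 : ℝ))) = χ y)
    (K : ℝ) (hK : ∀ y, |χ y| ≤ K)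
    (εs : ℕ → ℝ) (hεpos : ∀ n, 0 < εs n) (hεlim : Tendsto εs atTop (nhds 0))
    (g : (ℝ × ℝ) × ℝ → ℝ) (hg : Integrable g) :
    Tendsto (fun n => ∫ q, χ ((εs n)⁻¹ • q.1) * g q) atTop
      (nhds ((∫ y in Set.Icc ((0:ℝ), (0:ℝ)) (1, 1), χ y) * ∫ q, g q)) := by
  have hK0 : 0 ≤ K := (abs_nonneg _).trans (hK 0)
  set ν : Measure (ℝ × ℝ) := volume.restrict (Set.Icc ((0:ℝ), (0:ℝ)) (1, 1)) with hν
  have hν1 : IsProbabilityMeasure ν := by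
    constructor
    rw [hν, Measure.restrict_apply_univ, ← Set.Icc_prod_Icc, Measure.volume_eq_prod,
      Measure.prod_prod]
    simp
  have hint : ∀ n, Integrable (Function.uncurry fun (q : (ℝ × ℝ) × ℝ) (y : ℝ × ℝ) =>
      χ ((εs n)⁻¹ • q.1 + y) * g q) (volume.prod ν) := by
    intro n
    refine Integrable.bdd_mul (c := K) (hg.comp_fst ν) ?_ ?_
    · refine Measurable.aestronglyMeasurable ?_
      exact hχ_meas.comp (by fun_prop)
    · exact Eventually.of_forall fun _ => hK _
  have hχg : ∀ n (y : ℝ × ℝ) (f : (ℝ × ℝ) × ℝ → ℝ), Integrable f →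
      Integrable (fun q : (ℝ × ℝ) × ℝ => χ ((εs n)⁻¹ • q.1 + y) * f q) := by
    intro n y f hf
    refine Integrable.bdd_mul (c := K) hf ?_ ?_
    · refine Measurable.aestronglyMeasurable ?_
      exact hχ_meas.comp (by fun_prop)
    · exact Eventually.of_forall fun _ => hK _
  have hJ : ∀ n, ∫ y, (∫ q : (ℝ × ℝ) × ℝ, χ ((εs n)⁻¹ • q.1 + y) * g q) ∂ν =
      (∫ y, χ y ∂ν) * ∫ q, g q := by
    intro n
    rw [← integral_integral_swap (hint n), ← integral_const_mul]
    refine integral_congr_ae (Eventually.of_forall fun q => ?_)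
    simp only [integral_mul_const]
    rw [aux_per2 χ hχ_meas hχ_per K hK]
  have hshift : ∀ n (y : ℝ × ℝ), Integrable (fun q => g ((-(εs n • y), (0:ℝ)) + q)) :=
    fun n y => hg.comp_add_left _
  have hJ2 : ∀ n (y : ℝ × ℝ), ∫ q : (ℝ × ℝ) × ℝ, χ ((εs n)⁻¹ • q.1 + y) * g q =
      ∫ q : (ℝ × ℝ) × ℝ, χ ((εs n)⁻¹ • q.1) * g ((-(εs n • y), (0:ℝ)) + q) := by
    intro n y
    rw [← integral_add_left_eq_self _ ((-(εs n • y), (0:ℝ)) : (ℝ × ℝ) × ℝ)]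
    refine integral_congr_ae (Eventually.of_forall fun q => ?_)
    have : (εs n)⁻¹ • (((-(εs n • y), (0:ℝ)) : (ℝ × ℝ) × ℝ) + q).1 + y = (εs n)⁻¹ • q.1 := by
      rw [Prod.fst_add, smul_add, smul_neg, inv_smul_smul₀ (hεpos n).ne']
      abel
    simp only [this]
  have hbd : ∀ n (y : ℝ × ℝ), ‖(∫ q : (ℝ × ℝ) × ℝ, χ ((εs n)⁻¹ • q.1 + y) * g q) -
      ∫ q : (ℝ × ℝ) × ℝ, χ ((εs n)⁻¹ • q.1) * g q‖ ≤
      K * ∫ q, ‖g ((-(εs n • y), (0:ℝ)) + q) - g q‖ := by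
    intro n y
    rw [hJ2, ← integral_sub (by simpa using hχg n 0 _ (hshift n y))
      (by simpa using hχg n 0 _ hg), ← integral_const_mul]
    refine norm_integral_le_of_norm_le (((hshift n y).sub hg).norm.const_mul K) ?_
    refine Eventually.of_forall fun q => ?_
    rw [← mul_sub, norm_mul]
    exact mul_le_mul_of_nonneg_right (hK _) (norm_nonneg _)
  have hbd2 : ∀ n (y : ℝ × ℝ), ∫ q, ‖g ((-(εs n • y), (0:ℝ)) + q) - g q‖ ≤
      2 * ∫ q, ‖g q‖ := by
    intro n y
    calc _ ≤ ∫ q, (‖g ((-(εs n • y), (0:ℝ)) + q)‖ + ‖g q‖) :=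
          integral_mono ((hshift n y).sub hg).norm ((hshift n y).norm.add hg.norm)
            (fun q => norm_sub_le _ _)
      _ = _ := by
          rw [integral_add (hshift n y).norm hg.norm,
            integral_add_left_eq_self (fun q => ‖g q‖)]
          ring
  have hlim : Tendsto (fun n => ∫ y, ((∫ q : (ℝ × ℝ) × ℝ, χ ((εs n)⁻¹ • q.1 + y) * g q) -
      ∫ q : (ℝ × ℝ) × ℝ, χ ((εs n)⁻¹ • q.1) * g q) ∂ν) atTop (nhds (∫ _y, (0:ℝ) ∂ν)) := by
    refine tendsto_integral_of_dominated_convergence (fun _ => K * (2 * ∫ q, ‖g q‖)) ?_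
      (integrable_const _) ?_ ?_
    · intro n
      exact (hint n).integral_prod_right.aestronglyMeasurable.sub aestronglyMeasurable_const
    · intro n
      exact Eventually.of_forall fun y => (hbd n y).trans
        (mul_le_mul_of_nonneg_left (hbd2 n y) hK0)
    · refine Eventually.of_forall fun y => squeeze_zero_norm (fun n => hbd n y) ?_
      have := (aux_trans g hg (fun n => (-(εs n • y), (0:ℝ))) ?_).const_mul K
      · simpa using this
      · have : Tendsto (fun n => (-(εs n • y), (0:ℝ))) atTop (nhds (-((0:ℝ) • y), (0:ℝ))) :=
          ((hεlim.smul_const y).neg).prodMk_nhds tendsto_const_nhds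
        rw [zero_smul, neg_zero] at this
        exact this
  have hfin : ∀ n, ∫ y, ((∫ q : (ℝ × ℝ) × ℝ, χ ((εs n)⁻¹ • q.1 + y) * g q) -
      ∫ q : (ℝ × ℝ) × ℝ, χ ((εs n)⁻¹ • q.1) * g q) ∂ν = (∫ y, χ y ∂ν) * (∫ q, g q) -
      ∫ q : (ℝ × ℝ) × ℝ, χ ((εs n)⁻¹ • q.1) * g q := by
    intro n
    have hi : Integrable (fun y => ∫ q : (ℝ × ℝ) × ℝ, χ ((εs n)⁻¹ • q.1 + y) * g q) ν :=
      (hint n).integral_prod_right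
    rw [integral_sub hi (integrable_const _), hJ]
    simp
  simp only [hfin, integral_zero] at hlim
  simpa using (tendsto_const_nhds (x := (∫ y, χ y ∂ν) * (∫ q, g q))).sub hlim

/-- With `wₙ → w` a.e. in `Ω_T`, `|wₙ| ≤ M`, `χ` measurable,
`Y`-periodic and bounded, `εₙ → 0⁺`, `φ` continuous and bounded on `cl(Ω) × [0,T]`,
and `φ₁` continuous, bounded and `Y`-periodic in its second argument, one has
`∫_{Ω_T} χ(x/εₙ) wₙ [φ(x,t) + εₙ φ₁(x, x/εₙ, t)] → (∫_Y χ) ∫_{Ω_T} w φ`. -/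
theorem stmt11_corrector_test_convergence
    (Ω : Set (ℝ × ℝ)) (hΩo : IsOpen Ω) (hΩb : Bornology.IsBounded Ω)
    (T : ℝ) (hT : 0 < T)
    (μ : Measure ((ℝ × ℝ) × ℝ))
    (hμ : μ = (volume.restrict Ω).prod (volume.restrict (Set.Ioo 0 T)))
    (χ : (ℝ × ℝ) → ℝ) (hχ_meas : Measurable χ)
    (hχ_per : ∀ (y : ℝ × ℝ) (k : ℤ),
      χ (y + (k : ℝ) • ((1 : ℝ), (0 : ℝ))) = χ y ∧
      χ (y + (k : ℝ) • ((0 : ℝ), (1 : ℝ))) = χ y)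
    (hχ_bd : ∃ K : ℝ, ∀ y, |χ y| ≤ K)
    (M : ℝ) (hM : 0 < M)
    (wn : ℕ → ((ℝ × ℝ) × ℝ) → ℝ) (w : ((ℝ × ℝ) × ℝ) → ℝ)
    (hwn_meas : ∀ n, Measurable (wn n)) (hw_meas : Measurable w)
    (hwn_bd : ∀ n, ∀ᵐ q ∂μ, |wn n q| ≤ M)
    (hwn_ae : ∀ᵐ q ∂μ, Tendsto (fun n => wn n q) atTop (nhds (w q)))
    (εs : ℕ → ℝ) (hεpos : ∀ n, 0 < εs n) (hεlim : Tendsto εs atTop (nhds 0))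
    (φ : (ℝ × ℝ) → ℝ → ℝ)
    (hφ_cont : ContinuousOn (fun q : (ℝ × ℝ) × ℝ => φ q.1 q.2)
      ((closure Ω) ×ˢ Set.Icc (0:ℝ) T))
    (hφ_bd : ∃ K : ℝ, ∀ x t, |φ x t| ≤ K)
    (φ₁ : (ℝ × ℝ) → (ℝ × ℝ) → ℝ → ℝ)
    (hφ₁_cont : Continuous (fun q : (ℝ × ℝ) × (ℝ × ℝ) × ℝ => φ₁ q.1 q.2.1 q.2.2))
    (hφ₁_bd : ∃ K : ℝ, ∀ x y t, |φ₁ x y t| ≤ K)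
    (hφ₁_per : ∀ (x y : ℝ × ℝ) (t : ℝ) (k : ℤ),
      φ₁ x (y + (k : ℝ) • ((1 : ℝ), (0 : ℝ))) t = φ₁ x y t ∧
      φ₁ x (y + (k : ℝ) • ((0 : ℝ), (1 : ℝ))) t = φ₁ x y t) :
    Tendsto
      (fun n => ∫ q, χ ((εs n)⁻¹ • q.1) * wn n q *
        (φ q.1 q.2 + εs n * φ₁ q.1 ((εs n)⁻¹ • q.1) q.2) ∂μ)
      atTop
      (nhds ((∫ y in Set.Icc ((0:ℝ), (0:ℝ)) (1, 1), χ y) *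
        ∫ q, w q * φ q.1 q.2 ∂μ)) := by
  obtain ⟨K, hK⟩ := hχ_bd
  obtain ⟨P, hP⟩ := hφ_bd
  obtain ⟨Q, hQ⟩ := hφ₁_bd
  have hK0 : 0 ≤ K := (abs_nonneg _).trans (hK 0)
  have hP0 : 0 ≤ P := (abs_nonneg _).trans (hP 0 0)
  have hQ0 : 0 ≤ Q := (abs_nonneg _).trans (hQ 0 0 0)
  have hS : MeasurableSet (Ω ×ˢ Set.Ioo (0:ℝ) T) := hΩo.measurableSet.prod measurableSet_Ioo
  have hμ2 : μ = volume.restrict (Ω ×ˢ Set.Ioo (0:ℝ) T) := by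
    rw [hμ, Measure.prod_restrict]; rfl
  have hfin : IsFiniteMeasure μ := by
    rw [hμ2]
    exact isFiniteMeasure_restrict.2 (hΩb.prod (Metric.isBounded_Ioo 0 T)).measure_lt_top.ne
  have hφm : AEStronglyMeasurable (fun q : (ℝ × ℝ) × ℝ => φ q.1 q.2) μ := by
    rw [hμ2]
    exact (hφ_cont.mono (Set.prod_mono subset_closure Set.Ioo_subset_Icc_self)).aestronglyMeasurable hS
  have hw_bd : ∀ᵐ q ∂μ, |w q| ≤ M := by
    filter_upwards [ae_all_iff.2 hwn_bd, hwn_ae] with q h1 h2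
    exact le_of_tendsto h2.abs (Eventually.of_forall h1)
  have hχm : ∀ n, Measurable (fun q : (ℝ × ℝ) × ℝ => χ ((εs n)⁻¹ • q.1)) := fun n =>
    hχ_meas.comp (by fun_prop)
  have hφ₁m : ∀ n, Measurable (fun q : (ℝ × ℝ) × ℝ => φ₁ q.1 ((εs n)⁻¹ • q.1) q.2) := fun n => by
    have : Continuous (fun q : (ℝ × ℝ) × ℝ => (q.1, (εs n)⁻¹ • q.1, q.2)) := by fun_prop
    exact (hφ₁_cont.comp this).measurable
  have hwφ : Integrable (fun q : (ℝ × ℝ) × ℝ => w q * φ q.1 q.2) μ := by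
    refine Integrable.of_bound (hw_meas.aestronglyMeasurable.mul hφm) (M * P) ?_
    filter_upwards [hw_bd] with q hq
    rw [norm_mul]
    exact mul_le_mul hq (hP _ _) (norm_nonneg _) hM.le
  have hA : Tendsto (fun n => ∫ q, χ ((εs n)⁻¹ • q.1) * (w q * φ q.1 q.2) ∂μ) atTop
      (nhds ((∫ y in Set.Icc ((0:ℝ), (0:ℝ)) (1, 1), χ y) * ∫ q, w q * φ q.1 q.2 ∂μ)) := by
    have hgi : Integrable ((Ω ×ˢ Set.Ioo (0:ℝ) T).indicator
        (fun q : (ℝ × ℝ) × ℝ => w q * φ q.1 q.2)) := by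
      rw [integrable_indicator_iff hS]
      rw [hμ2] at hwφ
      exact hwφ
    have := aux_weak χ hχ_meas hχ_per K hK εs hεpos hεlim _ hgi
    rw [integral_indicator hS, ← hμ2] at this
    refine this.congr fun n => ?_
    rw [hμ2, ← integral_indicator hS]
    refine integral_congr_ae (Eventually.of_forall fun q => ?_)
    by_cases hq : q ∈ Ω ×ˢ Set.Ioo (0:ℝ) T
    · simp only [Set.indicator_of_mem hq]
    · simp only [Set.indicator_of_notMem hq, mul_zero]
  have hχwφ : ∀ n, Integrable (fun q : (ℝ × ℝ) × ℝ => χ ((εs n)⁻¹ • q.1) * (w q * φ q.1 q.2)) μ :=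
    fun n => hwφ.bdd_mul (c := K) (hχm n).aestronglyMeasurable (Eventually.of_forall fun _ => hK _)
  obtain ⟨E, hE⟩ : ∃ E, ∀ n, εs n ≤ E := by
    obtain ⟨E, hE⟩ := hεlim.bddAbove_range
    exact ⟨E, fun n => hE ⟨n, rfl⟩⟩
  have hE0 : 0 ≤ E := (hεpos 0).le.trans (hE 0)
  have hψm : ∀ n, AEStronglyMeasurable (fun q : (ℝ × ℝ) × ℝ =>
      φ q.1 q.2 + εs n * φ₁ q.1 ((εs n)⁻¹ • q.1) q.2) μ := fun n =>
    hφm.add ((hφ₁m n).const_mul _).aestronglyMeasurable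
  have hψb : ∀ n (q : (ℝ × ℝ) × ℝ), ‖φ q.1 q.2 + εs n * φ₁ q.1 ((εs n)⁻¹ • q.1) q.2‖ ≤ P + E * Q := by
    intro n q
    refine (norm_add_le _ _).trans (add_le_add (hP _ _) ?_)
    rw [norm_mul, Real.norm_of_nonneg (hεpos n).le]
    exact mul_le_mul (hE n) (hQ _ _ _) (norm_nonneg _) hE0
  have hFm : ∀ n, AEStronglyMeasurable (fun q : (ℝ × ℝ) × ℝ => χ ((εs n)⁻¹ • q.1) * wn n q *
        (φ q.1 q.2 + εs n * φ₁ q.1 ((εs n)⁻¹ • q.1) q.2)) μ := fun n =>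
    ((hχm n).mul (hwn_meas n)).aestronglyMeasurable.mul (hψm n)
  have hFb : ∀ n, ∀ᵐ q ∂μ, ‖χ ((εs n)⁻¹ • q.1) * wn n q *
        (φ q.1 q.2 + εs n * φ₁ q.1 ((εs n)⁻¹ • q.1) q.2)‖ ≤ K * M * (P + E * Q) := by
    intro n
    filter_upwards [hwn_bd n] with q hq
    rw [norm_mul, norm_mul]
    exact mul_le_mul (mul_le_mul (hK _) hq (norm_nonneg _) hK0) (hψb n q) (norm_nonneg _)
      (mul_nonneg hK0 hM.le)
  have hFi := fun n => Integrable.of_bound (hFm n) _ (hFb n)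
  have hB : Tendsto (fun n => ∫ q, (χ ((εs n)⁻¹ • q.1) * wn n q *
        (φ q.1 q.2 + εs n * φ₁ q.1 ((εs n)⁻¹ • q.1) q.2) -
        χ ((εs n)⁻¹ • q.1) * (w q * φ q.1 q.2)) ∂μ) atTop (nhds (∫ _q, (0:ℝ) ∂μ)) := by
    refine tendsto_integral_of_dominated_convergence
      (fun _ => K * M * (P + E * Q) + K * (M * P)) ?_ (integrable_const _) ?_ ?_
    · exact fun n => ((hFi n).sub (hχwφ n)).aestronglyMeasurable
    · intro n
      filter_upwards [hFb n, hw_bd] with q h1 h2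
      refine (norm_sub_le _ _).trans (add_le_add h1 ?_)
      rw [norm_mul, norm_mul]
      exact mul_le_mul (hK _) (mul_le_mul h2 (hP _ _) (norm_nonneg _) hM.le)
        (mul_nonneg (norm_nonneg _) (norm_nonneg _)) hK0
    · filter_upwards [hwn_ae] with q hq
      have h1 : Tendsto (fun n => εs n * φ₁ q.1 ((εs n)⁻¹ • q.1) q.2) atTop (nhds 0) := by
        refine squeeze_zero_norm (a := fun n => εs n * Q) (fun n => ?_) (by simpa using hεlim.mul_const Q)
        rw [norm_mul, Real.norm_of_nonneg (hεpos n).le]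
        exact mul_le_mul_of_nonneg_left (hQ _ _ _) (hεpos n).le
      have h2 : Tendsto (fun n => wn n q * (φ q.1 q.2 + εs n * φ₁ q.1 ((εs n)⁻¹ • q.1) q.2)
          - w q * φ q.1 q.2) atTop (nhds 0) := by
        simpa using (hq.mul (h1.const_add (φ q.1 q.2))).sub_const (w q * φ q.1 q.2)
      have h3 := (h2.norm).const_mul K
      rw [norm_zero, mul_zero] at h3
      refine squeeze_zero_norm (fun n => ?_) h3
      rw [mul_assoc, ← mul_sub, norm_mul]
      exact mul_le_mul_of_nonneg_right (hK _) (norm_nonneg _)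
  have hC := hB.add hA
  rw [integral_zero, zero_add] at hC
  refine hC.congr fun n => ?_
  rw [integral_sub (hFi n) (hχwφ n)]
  ring
end
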